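/- Let B0 be an [n,t] linear code over a field F and let C be an [n,k] linear code over F with 1 ≤ k ≤ n − t, such that (a) B0 is a subspace of C^⊥, and (b) every subset S of {1,…,n} with |S| = k that is a k-core of B0 is also a k-core of C^⊥. Then the generalized Hamming weights of C^⊥ are given by: d_i(C^⊥) = d_i(B0) for 1 ≤ i ≤ g_k(B0) − k, and d_i(C^⊥) = i + k for g_k(B0) − k + 1 ≤ i ≤ n − k, where g_k(B0) is the k-th gap of B0. -/

import Mathlib

open Classical in
/-- The support of a vector: the set of coordinates where it is nonzero. -/
noncomputable def vsupp {F : Type*} [Field F] {n : ℕ} (v : Fin n → F) : Finset (Fin n) :=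
  Finset.univ.filter (fun i => v i ≠ 0)

open Classical in
/-- The support of a subspace: the union of the supports of its vectors. -/
noncomputable def codeSupp {F : Type*} [Field F] {n : ℕ}
    (D : Submodule F (Fin n → F)) : Finset (Fin n) :=
  Finset.univ.filter (fun i => ∃ v ∈ D, v i ≠ 0)

/-- The dual code w.r.t. the standard bilinear form `⟨x,y⟩ = ∑ x i * y i`. -/
def dualCode {F : Type*} [Field F] {n : ℕ} (C : Submodule F (Fin n → F)) :
    Submodule F (Fin n → F) where
  carrier := {w | ∀ v ∈ C, ∑ i, v i * w i = 0}
  zero_mem' := by intro v _; simp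
  add_mem' := by
    intro a b ha hb v hv
    have h : ∑ i, v i * (a + b) i = (∑ i, v i * a i) + ∑ i, v i * b i := by
      simp [mul_add, Finset.sum_add_distrib]
    rw [h, ha v hv, hb v hv, add_zero]
  smul_mem' := by
    intro c a ha v hv
    have h : ∑ i, v i * (c • a) i = c * ∑ i, v i * a i := by
      simp [Finset.mul_sum, mul_left_comm]
    rw [h, ha v hv, mul_zero]

/-- The `i`-th generalized Hamming weight (1-indexed): the minimum support cardinality
of an `i`-dimensional subspace. -/
noncomputable def ghw {F : Type*} [Field F] {n : ℕ} (C : Submodule F (Fin n → F)) (i : ℕ) : ℕ :=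
  sInf {s | ∃ D : Submodule F (Fin n → F), D ≤ C ∧ Module.finrank F D = i ∧ (codeSupp D).card = s}

/-- The set of gaps of a code: elements of `{1,…,n}` that are not generalized Hamming weights. -/
noncomputable def gapSet {F : Type*} [Field F] {n : ℕ} (C : Submodule F (Fin n → F)) : Finset ℕ :=
  (Finset.Icc 1 n) \ ((Finset.Icc 1 (Module.finrank F C)).image (ghw C))

/-- The `i`-th gap of a code (1-indexed), via the increasing enumeration of the gap set. -/
noncomputable def gapNum {F : Type*} [Field F] {n : ℕ} (C : Submodule F (Fin n → F)) (i : ℕ) : ℕ :=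
  ((gapSet C).sort (· ≤ ·)).getD (i - 1) 0

/-- The minimum distance of a code: the minimum Hamming weight of a nonzero codeword. -/
noncomputable def dmin {F : Type*} [Field F] {n : ℕ} (C : Submodule F (Fin n → F)) : ℕ :=
  sInf {w | ∃ v ∈ C, v ≠ 0 ∧ (vsupp v).card = w}

/-- `S` is an `ℓ`-core (`ℓ = S.card`) of `B` if no nonzero codeword of `B`
has its support contained in `S`. -/
def isCore {F : Type*} [Field F] {n : ℕ} (B : Submodule F (Fin n → F)) (S : Finset (Fin n)) : Prop :=
  ∀ v ∈ B, v ≠ 0 → ¬ (vsupp v ⊆ S)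

/-- The subspace of the dual code spanned by all its codewords of Hamming weight `≤ r+1`. -/
noncomputable def lowWtSpan {F : Type*} [Field F] {n : ℕ}
    (C : Submodule F (Fin n → F)) (r : ℕ) : Submodule F (Fin n → F) :=
  Submodule.span F {c | c ∈ dualCode C ∧ (vsupp c).card ≤ r + 1}

/-- `A_i`: the set of local parities covering coordinate `i`, i.e. dual codewords of
Hamming weight at most `r+1` whose support contains `i`. -/
def coveringParities {F : Type*} [Field F] {n : ℕ}
    (C : Submodule F (Fin n → F)) (r : ℕ) (i : Fin n) : Set (Fin n → F) :=
  {c | c ∈ dualCode C ∧ (vsupp c).card ≤ r + 1 ∧ c i ≠ 0}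

/-- `C` is locally 2-reconstructible with locality `r`: every `A_i` is nonempty
and `A_i ≠ A_j` for `i ≠ j`. -/
def Locally2Recon {F : Type*} [Field F] {n : ℕ}
    (C : Submodule F (Fin n → F)) (r : ℕ) : Prop :=
  (∀ i : Fin n, (coveringParities C r i).Nonempty) ∧
  (∀ i j : Fin n, i ≠ j → coveringParities C r i ≠ coveringParities C r j)

/-- The subcode of words of `B` whose support is contained in `S`. -/
def shortened {F : Type*} [Field F] {n : ℕ} (B : Submodule F (Fin n → F)) (S : Finset (Fin n)) :
    Submodule F (Fin n → F) where
  carrier := {v | v ∈ B ∧ ∀ i, i ∉ S → v i = 0}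
  zero_mem' := ⟨B.zero_mem, fun _ _ => rfl⟩
  add_mem' := by
    rintro a b ⟨ha, ha'⟩ ⟨hb, hb'⟩
    exact ⟨B.add_mem ha hb, fun i hi => by simp [ha' i hi, hb' i hi]⟩
  smul_mem' := by
    rintro c a ⟨ha, ha'⟩
    exact ⟨B.smul_mem c ha, fun i hi => by simp [ha' i hi]⟩

section Codes

variable {F : Type*} [Field F] {n : ℕ} {B B' : Submodule F (Fin n → F)} {S T : Finset (Fin n)}

theorem mem_shortened {v : Fin n → F} :
    v ∈ shortened B S ↔ v ∈ B ∧ ∀ i, i ∉ S → v i = 0 := Iff.rfl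

theorem shortened_le : shortened B S ≤ B := fun _ hv => hv.1

theorem shortened_mono_left (h : B ≤ B') : shortened B S ≤ shortened B' S :=
  fun _ hv => ⟨h hv.1, hv.2⟩

theorem shortened_univ : shortened B Finset.univ = B :=
  le_antisymm shortened_le fun _ hv => ⟨hv, fun _ hi => absurd (Finset.mem_univ _) hi⟩

theorem vsupp_subset_iff {v : Fin n → F} : vsupp v ⊆ S ↔ ∀ i, i ∉ S → v i = 0 := by
  simp only [vsupp, Finset.subset_iff, Finset.mem_filter, Finset.mem_univ, true_and]
  exact forall_congr' fun i => not_imp_comm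

theorem isCore_iff_shortened_eq_bot : isCore B S ↔ shortened B S = ⊥ := by
  rw [Submodule.eq_bot_iff]
  simp only [isCore, vsupp_subset_iff, mem_shortened]
  exact ⟨fun h v hv => by_contra fun h0 => h v hv.1 h0 hv.2,
    fun h v hv h0 hs => h0 (h v ⟨hv, hs⟩)⟩

theorem isCore.subset (h : isCore B S) (hTS : T ⊆ S) : isCore B T :=
  fun v hv h0 hs => h v hv h0 (hs.trans hTS)

theorem finrank_shortened_le_add (B : Submodule F (Fin n → F)) (S T : Finset (Fin n)) :
    Module.finrank F (shortened B S) ≤ Module.finrank F (shortened B T) + (S \ T).card := by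
  let f : shortened B S →ₗ[F] ((S \ T : Finset (Fin n)) → F) :=
    (LinearMap.funLeft F F (fun i : (S \ T : Finset (Fin n)) => (i : Fin n))).comp
      (shortened B S).subtype
  have hker : Module.finrank F (LinearMap.ker f) ≤ Module.finrank F (shortened B T) := by
    rw [← Submodule.finrank_map_subtype_eq (shortened B S) (LinearMap.ker f)]
    refine Submodule.finrank_mono ?_
    rintro _ ⟨v, hv, rfl⟩
    refine ⟨v.2.1, fun i hi => ?_⟩
    by_cases hS : i ∈ S
    · exact congrFun (LinearMap.mem_ker.mp hv) ⟨i, Finset.mem_sdiff.mpr ⟨hS, hi⟩⟩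
    · exact v.2.2 i hS
  have hrange : Module.finrank F (LinearMap.range f) ≤ (S \ T).card := by
    refine (Submodule.finrank_le (LinearMap.range f)).trans_eq ?_
    rw [Module.finrank_fintype_fun_eq_card, Fintype.card_coe]
  have := f.finrank_range_add_finrank_ker
  omega

theorem isCore.finrank_shortened_add_card_le (h : isCore B T) (hTS : T ⊆ S) :
    Module.finrank F (shortened B S) + T.card ≤ S.card := by
  have h1 := finrank_shortened_le_add B S T
  rw [isCore_iff_shortened_eq_bot.mp h, finrank_bot] at h1
  have := Finset.card_sdiff_add_card_eq_card hTS
  omega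

theorem isCore.exists_insert (h : isCore B T) (hTS : T ⊆ S)
    (hlt : T.card + Module.finrank F (shortened B S) < S.card) :
    ∃ x ∈ S \ T, isCore B (insert x T) := by
  by_contra! hcon
  have hex : ∀ x : (S \ T : Finset (Fin n)), ∃ v ∈ B, v x ≠ 0 ∧
      ∀ i, i ∉ insert (x : Fin n) T → v i = 0 := by
    intro x
    have hx := hcon x x.2
    simp only [isCore, vsupp_subset_iff] at hx
    push Not at hx
    obtain ⟨v, hv, h0, hs⟩ := hx
    refine ⟨v, hv, fun hvx => h v hv h0 (vsupp_subset_iff.mpr fun i hi => ?_), hs⟩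
    by_cases hix : i = x
    · rw [hix, hvx]
    · exact hs i (by simp [hix, hi])
  choose v hvB hvx hvs using hex
  have hmem : ∀ x, v x ∈ shortened B S := fun x =>
    ⟨hvB x, fun i hi => hvs x i fun hi' => hi <| by
      rcases Finset.mem_insert.mp hi' with rfl | hi'
      · exact (Finset.mem_sdiff.mp x.2).1
      · exact hTS hi'⟩
  have hli : LinearIndependent F fun x => (⟨v x, hmem x⟩ : shortened B S) := by
    rw [Fintype.linearIndependent_iff]
    intro c hc y
    have hc' := congrFun (congrArg Subtype.val hc) (y : Fin n)
    simp only [Submodule.coe_sum, Submodule.coe_smul, Finset.sum_apply, Pi.smul_apply,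
      smul_eq_mul, ZeroMemClass.coe_zero, Pi.zero_apply] at hc'
    rw [Finset.sum_eq_single y] at hc'
    · exact (mul_eq_zero.mp hc').resolve_right (hvx y)
    · intro x _ hxy
      rw [hvs x y, mul_zero]
      simp only [Finset.mem_insert, not_or]
      exact ⟨fun e => hxy (Subtype.ext e.symm), (Finset.mem_sdiff.mp y.2).2⟩
    · simp
  have h1 := hli.fintype_card_le_finrank
  have h2 := Finset.card_sdiff_add_card_eq_card hTS
  simp only [Fintype.card_coe] at h1
  omega

theorem isCore.exists_superset_card_eq (h : isCore B T) (hTS : T ⊆ S) {m : ℕ} (hm : T.card ≤ m)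
    (hmS : m + Module.finrank F (shortened B S) ≤ S.card) :
    ∃ U, T ⊆ U ∧ U ⊆ S ∧ U.card = m ∧ isCore B U := by
  induction m, hm using Nat.le_induction with
  | base => exact ⟨T, subset_rfl, hTS, rfl, h⟩
  | succ m _ ih =>
    obtain ⟨U, hTU, hUS, hU, hcU⟩ := ih (by omega)
    obtain ⟨x, hx, hcx⟩ := hcU.exists_insert hUS (by omega)
    rw [Finset.mem_sdiff] at hx
    exact ⟨insert x U, hTU.trans (Finset.subset_insert _ _), Finset.insert_subset hx.1 hUS,
      by rw [Finset.card_insert_of_notMem hx.2, hU], hcx⟩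

theorem isCore_empty : isCore B ∅ := fun v _ h0 hs =>
  h0 (funext fun i => vsupp_subset_iff.mp hs i (by simp))

/-- If every `k`-core of `B` is a core of `B'`, then the ranks of `B'` are at least those of the
truncation to `k` of the ranks of `B`. -/
theorem finrank_shortened_le_max {k : ℕ} (hk : k + Module.finrank F B ≤ n)
    (hcore : ∀ S : Finset (Fin n), S.card = k → isCore B S → isCore B' S)
    (S : Finset (Fin n)) :
    Module.finrank F (shortened B' S) ≤ Module.finrank F (shortened B S) ∨
      Module.finrank F (shortened B' S) + k ≤ S.card := by
  have hle : Module.finrank F (shortened B S) ≤ S.card := by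
    simpa using (isCore_empty (B := B)).finrank_shortened_add_card_le (Finset.empty_subset S)
  rcases le_total (k + Module.finrank F (shortened B S)) S.card with h | h
  · obtain ⟨U, -, hUS, hU, hcU⟩ := isCore_empty.exists_superset_card_eq
      (Finset.empty_subset S) (by simp) h
    have := (hcore U hU hcU).finrank_shortened_add_card_le hUS
    omega
  · obtain ⟨U, -, hUS, hU, hcU⟩ := (isCore_empty (B := B)).exists_superset_card_eq
      (m := S.card - Module.finrank F (shortened B S))
      (Finset.empty_subset S) (by simp) (by omega)
    obtain ⟨V, hUV, -, hV, hcV⟩ := hcU.exists_superset_card_eq (m := k)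
      (Finset.subset_univ U) (by omega) (by rw [shortened_univ]; simpa using hk)
    have := ((hcore V hV hcV).subset hUV).finrank_shortened_add_card_le hUS
    omega

theorem mem_codeSupp {D : Submodule F (Fin n → F)} {x : Fin n} :
    x ∈ codeSupp D ↔ ∃ v ∈ D, v x ≠ 0 := by
  simp [codeSupp]

theorem ghw_le_card {i : ℕ} (h : i ≤ Module.finrank F (shortened B S)) :
    ghw B i ≤ S.card := by
  obtain ⟨f, hf⟩ := exists_linearIndependent_of_le_finrank h
  have hf' : LinearIndependent F fun j => (f j : Fin n → F) :=
    hf.map' (shortened B S).subtype (Submodule.ker_subtype _)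
  have hD : Submodule.span F (Set.range fun j => (f j : Fin n → F)) ≤ shortened B S :=
    Submodule.span_le.mpr (by rintro _ ⟨j, rfl⟩; exact (f j).2)
  have hsupp : codeSupp (Submodule.span F (Set.range fun j => (f j : Fin n → F))) ⊆ S := by
    intro x hx
    obtain ⟨v, hv, hvx⟩ := mem_codeSupp.mp hx
    exact by_contra fun hxS => hvx ((hD hv).2 x hxS)
  refine le_trans ?_ (Finset.card_le_card hsupp)
  exact Nat.sInf_le ⟨_, hD.trans shortened_le,
    by rw [finrank_span_eq_card hf', Fintype.card_fin], rfl⟩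

theorem exists_card_eq_ghw {i : ℕ} (h : i ≤ Module.finrank F B) :
    ∃ S : Finset (Fin n), S.card = ghw B i ∧ i ≤ Module.finrank F (shortened B S) := by
  obtain ⟨f, hf⟩ := exists_linearIndependent_of_le_finrank h
  have hf' : LinearIndependent F fun j => (f j : Fin n → F) :=
    hf.map' B.subtype (Submodule.ker_subtype _)
  obtain ⟨D, hDB, hDi, hD⟩ := Nat.sInf_mem
    (s := {s | ∃ D : Submodule F (Fin n → F), D ≤ B ∧ Module.finrank F D = i ∧
      (codeSupp D).card = s})
    ⟨_, Submodule.span F (Set.range fun j => (f j : Fin n → F)),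
      Submodule.span_le.mpr (by rintro _ ⟨j, rfl⟩; exact (f j).2),
      by rw [finrank_span_eq_card hf', Fintype.card_fin], rfl⟩
  refine ⟨codeSupp D, hD, hDi ▸ Submodule.finrank_mono fun v hv => ⟨hDB hv, fun x hx => ?_⟩⟩
  by_contra h0
  exact hx (mem_codeSupp.mpr ⟨v, hv, h0⟩)

theorem ghw_le_length {i : ℕ} (h : i ≤ Module.finrank F B) : ghw B i ≤ n := by
  obtain ⟨S, hS, -⟩ := exists_card_eq_ghw h
  exact hS ▸ card_finset_fin_le S

theorem le_ghw {i : ℕ} (h : i ≤ Module.finrank F B) : i ≤ ghw B i := by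
  obtain ⟨S, hS, hi⟩ := exists_card_eq_ghw h
  have : Module.finrank F (shortened B S) ≤ S.card := by
    simpa using (isCore_empty (B := B)).finrank_shortened_add_card_le (Finset.empty_subset S)
  omega

theorem ghw_lt_ghw_succ {i : ℕ} (h : i + 1 ≤ Module.finrank F B) : ghw B i < ghw B (i + 1) := by
  obtain ⟨S, hS, hi⟩ := exists_card_eq_ghw h
  have hpos : 0 < S.card := by
    have := le_ghw h
    omega
  obtain ⟨x, hx⟩ := Finset.card_pos.mp hpos
  have h1 := finrank_shortened_le_add B S (S.erase x)
  rw [Finset.sdiff_erase_self hx, Finset.card_singleton] at h1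
  have h2 := ghw_le_card (B := B) (S := S.erase x) (i := i) (by omega)
  rw [Finset.card_erase_of_mem hx] at h2
  omega

theorem ghw_strictMonoOn (B : Submodule F (Fin n → F)) :
    StrictMonoOn (ghw B) (Set.Icc 1 (Module.finrank F B)) := by
  rintro i - j ⟨-, hj⟩ hij
  induction j, hij using Nat.le_induction with
  | base => exact ghw_lt_ghw_succ hj
  | succ j _ ih => exact (ih (by omega)).trans (ghw_lt_ghw_succ hj)

theorem card_Icc_one (m : ℕ) : (Finset.Icc 1 m).card = m := by simp

theorem card_gaps_le_add_card_ghw_le (B : Submodule F (Fin n → F)) {m : ℕ} (hm : m ≤ n) :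
    ((gapSet B).filter (· ≤ m)).card +
      ((Finset.Icc 1 (Module.finrank F B)).filter (ghw B · ≤ m)).card = m := by
  have hinj : Set.InjOn (ghw B)
      ((Finset.Icc 1 (Module.finrank F B)).filter (ghw B · ≤ m) : Finset ℕ) :=
    (ghw_strictMonoOn B).injOn.mono fun i hi => by
      simp only [Finset.coe_filter, Finset.mem_Icc, Set.mem_ofPred_eq] at hi
      exact hi.1
  rw [← Finset.card_image_of_injOn hinj, ← Finset.card_union_of_disjoint]
  · conv_rhs => rw [← card_Icc_one m]
    congr 1
    ext x
    simp only [gapSet, Finset.mem_union, Finset.mem_filter, Finset.mem_sdiff, Finset.mem_Icc,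
      Finset.mem_image]
    constructor
    · rintro (h | ⟨i, ⟨hi, him⟩, rfl⟩)
      · exact ⟨h.1.1.1, h.2⟩
      · exact ⟨hi.1.trans (le_ghw hi.2), him⟩
    · rintro ⟨h1, h2⟩
      by_cases hx : ∃ i, (1 ≤ i ∧ i ≤ Module.finrank F B) ∧ ghw B i = x
      · obtain ⟨i, hi, rfl⟩ := hx
        exact Or.inr ⟨i, ⟨hi, h2⟩, rfl⟩
      · exact Or.inl ⟨⟨⟨h1, h2.trans hm⟩, hx⟩, h2⟩
  · rw [Finset.disjoint_left]
    intro x hx hx'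
    simp only [gapSet, Finset.mem_filter, Finset.mem_sdiff] at hx
    exact hx.1.2 (Finset.image_subset_image (Finset.filter_subset _ _) hx')

theorem card_ghw_le_ghw {i : ℕ} (h1 : 1 ≤ i) (hi : i ≤ Module.finrank F B) :
    ((Finset.Icc 1 (Module.finrank F B)).filter (ghw B · ≤ ghw B i)).card = i := by
  conv_rhs => rw [← card_Icc_one i]
  congr 1
  ext j
  simp only [Finset.mem_filter, Finset.mem_Icc]
  constructor
  · rintro ⟨hj, hle⟩
    exact ⟨hj.1, ((ghw_strictMonoOn B).le_iff_le hj ⟨h1, hi⟩).mp hle⟩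
  · rintro ⟨hj1, hji⟩
    have hj : 1 ≤ j ∧ j ≤ Module.finrank F B := ⟨hj1, hji.trans hi⟩
    exact ⟨hj, ((ghw_strictMonoOn B).le_iff_le hj ⟨h1, hi⟩).mpr hji⟩

theorem card_gapSet_add_finrank (B : Submodule F (Fin n → F)) :
    (gapSet B).card + Module.finrank F B = n := by
  have h := card_gaps_le_add_card_ghw_le B le_rfl
  rw [Finset.filter_true_of_mem, Finset.filter_true_of_mem, card_Icc_one] at h
  · exact h
  · exact fun i hi => ghw_le_length (Finset.mem_Icc.mp hi).2
  · intro x hx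
    simp only [gapSet, Finset.mem_sdiff, Finset.mem_Icc] at hx
    exact hx.1.2

theorem gapNum_mem {k : ℕ} (hk1 : 1 ≤ k) (hk : k + Module.finrank F B ≤ n) :
    gapNum B k ∈ gapSet B ∧ ((gapSet B).filter (· < gapNum B k)).card = k - 1 := by
  have hlt : k - 1 < (gapSet B).card := by
    have := card_gapSet_add_finrank B
    omega
  have he : gapNum B k = (gapSet B).orderEmbOfFin rfl ⟨k - 1, hlt⟩ := by
    rw [Finset.orderEmbOfFin_apply, gapNum, List.getD_eq_getElem]
    rfl
  rw [he]
  refine ⟨Finset.orderEmbOfFin_mem _ _ _, ?_⟩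
  have himg : (gapSet B).filter (· < (gapSet B).orderEmbOfFin rfl ⟨k - 1, hlt⟩) =
      (Finset.Iio ⟨k - 1, hlt⟩).map ((gapSet B).orderEmbOfFin rfl).toEmbedding := by
    ext x
    simp only [Finset.mem_filter, Finset.mem_map, Finset.mem_Iio, RelEmbedding.coe_toEmbedding]
    constructor
    · rintro ⟨hx, hxlt⟩
      rw [← Finset.mem_coe, ← Finset.range_orderEmbOfFin (gapSet B) rfl] at hx
      obtain ⟨j, rfl⟩ := hx
      exact ⟨j, (OrderEmbedding.lt_iff_lt _).mp hxlt, rfl⟩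
    · rintro ⟨j, hj, rfl⟩
      exact ⟨Finset.orderEmbOfFin_mem _ _ _, (OrderEmbedding.lt_iff_lt _).mpr hj⟩
  rw [himg, Finset.card_map, Fin.card_Iio]

theorem card_gaps_le_gapNum {k : ℕ} (hk1 : 1 ≤ k) (hk : k + Module.finrank F B ≤ n) :
    ((gapSet B).filter (· ≤ gapNum B k)).card = k := by
  obtain ⟨hg, hc⟩ := gapNum_mem hk1 hk
  have : (gapSet B).filter (· ≤ gapNum B k) =
      insert (gapNum B k) ((gapSet B).filter (· < gapNum B k)) := by
    ext x
    simp only [Finset.mem_filter, Finset.mem_insert, le_iff_lt_or_eq]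
    constructor
    · rintro ⟨hx, h | h⟩
      · exact Or.inr ⟨hx, h⟩
      · exact Or.inl h
    · rintro (rfl | ⟨hx, h⟩)
      · exact ⟨hg, Or.inr rfl⟩
      · exact ⟨hx, Or.inl h⟩
  rw [this, Finset.card_insert_of_notMem (by simp), hc]
  omega

theorem gapNum_le_length {k : ℕ} (hk1 : 1 ≤ k) (hk : k + Module.finrank F B ≤ n) :
    gapNum B k ≤ n := by
  have hg := (gapNum_mem hk1 hk).1
  simp only [gapSet, Finset.mem_sdiff, Finset.mem_Icc] at hg
  exact hg.1.2

theorem gapNum_sub_le_finrank {k : ℕ} (hk1 : 1 ≤ k) (hk : k + Module.finrank F B ≤ n) :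
    gapNum B k - k ≤ Module.finrank F B := by
  have h1 := card_gaps_le_add_card_ghw_le B (gapNum_le_length hk1 hk)
  rw [card_gaps_le_gapNum hk1 hk] at h1
  have h2 := Finset.card_filter_le (Finset.Icc 1 (Module.finrank F B)) (ghw B · ≤ gapNum B k)
  rw [card_Icc_one] at h2
  omega

theorem ghw_lt_add_iff_le_gapNum_sub {k i : ℕ} (hk1 : 1 ≤ k) (hk : k + Module.finrank F B ≤ n)
    (h1 : 1 ≤ i) (hi : i ≤ Module.finrank F B) :
    ghw B i < i + k ↔ i ≤ gapNum B k - k := by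
  obtain ⟨hg, hc⟩ := gapNum_mem hk1 hk
  have hgn := gapNum_le_length hk1 hk
  have hcg := card_gaps_le_add_card_ghw_le B hgn
  rw [card_gaps_le_gapNum hk1 hk] at hcg
  have hcd := card_gaps_le_add_card_ghw_le B (ghw_le_length hi)
  rw [card_ghw_le_ghw h1 hi] at hcd
  rcases lt_trichotomy (ghw B i) (gapNum B k) with hlt | heq | hgt
  · have hle : ((gapSet B).filter (· ≤ ghw B i)).card ≤ k - 1 := hc ▸ Finset.card_le_card
      (Finset.monotone_filter_right _ fun x _ hx => lt_of_le_of_lt hx hlt)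
    have hle' : i ≤ ((Finset.Icc 1 (Module.finrank F B)).filter (ghw B · ≤ gapNum B k)).card := by
      conv_lhs => rw [← card_ghw_le_ghw h1 hi]
      exact Finset.card_le_card
        (Finset.monotone_filter_right _ fun x _ hx => le_trans hx hlt.le)
    exact iff_of_true (by omega) (by omega)
  · rw [← heq] at hg
    exact absurd (Finset.mem_image_of_mem _ (Finset.mem_Icc.mpr ⟨h1, hi⟩))
      (Finset.mem_sdiff.mp hg).2
  · have hle : k ≤ ((gapSet B).filter (· ≤ ghw B i)).card := by
      conv_lhs => rw [← card_gaps_le_gapNum hk1 hk]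
      exact Finset.card_le_card
        (Finset.monotone_filter_right _ fun x _ hx => le_trans hx hgt.le)
    have hle' : ((Finset.Icc 1 (Module.finrank F B)).filter (ghw B · ≤ gapNum B k)).card < i := by
      conv_rhs => rw [← card_ghw_le_ghw h1 hi]
      refine Finset.card_lt_card (Finset.ssubset_iff_subset_ne.mpr
        ⟨Finset.monotone_filter_right _ fun x _ hx => le_trans hx hgt.le, fun h => ?_⟩)
      have hmem : i ∈ (Finset.Icc 1 (Module.finrank F B)).filter (ghw B · ≤ ghw B i) := by
        simp [h1, hi]
      rw [← h] at hmem
      exact absurd (Finset.mem_filter.mp hmem).2 (not_le.mpr hgt)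
    exact iff_of_false (by omega) (by omega)

theorem length_le_finrank_dualCode_add (C : Submodule F (Fin n → F)) :
    n ≤ Module.finrank F (dualCode C) + Module.finrank F C := by
  let f : (Fin n → F) →ₗ[F] Module.Dual F C :=
    ((dotProductBilin F F).comp C.subtype).flip
  have hker : LinearMap.ker f ≤ dualCode C := by
    intro w hw v hv
    exact LinearMap.congr_fun (LinearMap.mem_ker.mp hw) ⟨v, hv⟩
  have h1 := f.finrank_range_add_finrank_ker
  have h2 := Submodule.finrank_mono hker
  have h3 := Submodule.finrank_le (LinearMap.range f)
  rw [Subspace.dual_finrank_eq] at h3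
  rw [Module.finrank_fin_fun] at h1
  omega

end Codes

/-- Theorem 2 of the paper: under the `k`-core hypotheses, the GHWs
of `C^⊥` satisfy `d_i(C^⊥) = d_i(B0)` for `1 ≤ i ≤ g_k(B0) - k`, and
`d_i(C^⊥) = i + k` for `g_k(B0) - k + 1 ≤ i ≤ n - k`. -/
theorem stmt4 {F : Type*} [Field F] {n t k : ℕ}
    (B0 C : Submodule F (Fin n → F))
    (ht : Module.finrank F B0 = t) (hC : Module.finrank F C = k)
    (hk1 : 1 ≤ k) (hkt : k ≤ n - t)
    (hsub : B0 ≤ dualCode C)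
    (hcore : ∀ S : Finset (Fin n), S.card = k → isCore B0 S → isCore (dualCode C) S) :
    (∀ i, 1 ≤ i → i ≤ gapNum B0 k - k → ghw (dualCode C) i = ghw B0 i) ∧
    (∀ i, gapNum B0 k - k + 1 ≤ i → i ≤ n - k → ghw (dualCode C) i = i + k) := by
  have hBn : Module.finrank F B0 ≤ n := by
    simpa using Submodule.finrank_le B0
  have hk : k + Module.finrank F B0 ≤ n := by omega
  have hdual := length_le_finrank_dualCode_add C
  have hmax := finrank_shortened_le_max hk hcore
  refine ⟨fun i h1 hi => ?_, fun i h1 hi => ?_⟩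
  · have hit := hi.trans (gapNum_sub_le_finrank hk1 hk)
    have hlt := (ghw_lt_add_iff_le_gapNum_sub hk1 hk h1 hit).mpr hi
    apply le_antisymm
    · obtain ⟨S, hS, hSi⟩ := exists_card_eq_ghw hit
      exact hS ▸ ghw_le_card (hSi.trans (Submodule.finrank_mono (shortened_mono_left hsub)))
    · obtain ⟨S, hS, hSi⟩ := exists_card_eq_ghw (hit.trans (Submodule.finrank_mono hsub))
      rcases hmax S with h | h
      · exact hS ▸ ghw_le_card (hSi.trans h)
      · omega
  · have hid : i ≤ Module.finrank F (dualCode C) := by omega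
    apply le_antisymm
    · obtain ⟨S, -, hS⟩ := Finset.exists_subset_card_eq
        (s := (Finset.univ : Finset (Fin n))) (n := i + k) (by simp; omega)
      have h2 := finrank_shortened_le_add (dualCode C) Finset.univ S
      rw [shortened_univ, ← Finset.compl_eq_univ_sdiff, Finset.card_compl, Fintype.card_fin] at h2
      exact hS ▸ ghw_le_card (by omega)
    · obtain ⟨S, hS, hSi⟩ := exists_card_eq_ghw hid
      rcases hmax S with h | h
      · have hit : i ≤ Module.finrank F B0 :=
          hSi.trans (h.trans (Submodule.finrank_mono shortened_le))
        have h2 := ghw_lt_add_iff_le_gapNum_sub hk1 hk (by omega) hit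
        have h3 := ghw_le_card (hSi.trans h)
        omega
      · omega
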